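/- Define h : P(ℕ) → P(ℕ) by h(A) = A if A has cototal enumeration degree and h(A) = A^⋄ otherwise. Then h is a Borel e-invariant function, and for every X ⊆ ℕ there exist A, B with X ≤_e A and X ≤_e B such that: A ≤_e h(A), B ≰_e h(B), h(A) <_e A^⋄, and B^⋄ ≤_e h(B). Consequently, h is not constant, not increasing, and not comparable to either the enumeration jump or the skip on any upper cone of enumeration degrees. -/

import Mathlib

open Classical

/-- The `e`-th computably enumerable subset of `ℕ` (the domain of the `e`-th
partial computable function). -/
def ceSet (e : ℕ) : Set ℕ :=
  {n | ((Denumerable.ofNat Nat.Partrec.Code e).eval n).Dom}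

/-- The finite set canonically coded by `u` (via binary expansion). -/
def finCode (u : ℕ) : Set ℕ := {n | Nat.testBit u n}

/-- The `i`-th enumeration operator applied to `B`. -/
def eOp (i : ℕ) (B : Set ℕ) : Set ℕ :=
  {n | ∃ u : ℕ, Nat.pair n u ∈ ceSet i ∧ finCode u ⊆ B}

/-- `A ≤ₑ B` via the index `i`. -/
def ELeVia (A B : Set ℕ) (i : ℕ) : Prop := A = eOp i B

/-- Enumeration reducibility. -/
def ELe (A B : Set ℕ) : Prop := ∃ i, ELeVia A B i

/-- `A ≡ₑ B` via the pair of indices `⟨i,j⟩`. -/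
def EEquivVia (A B : Set ℕ) (i j : ℕ) : Prop := ELeVia A B i ∧ ELeVia B A j

/-- Enumeration equivalence. -/
def EEquiv (A B : Set ℕ) : Prop := ELe A B ∧ ELe B A

/-- Strict enumeration reducibility. -/
def ELt (A B : Set ℕ) : Prop := ELe A B ∧ ¬ ELe B A

/-- The enumeration degree of `A`, i.e. its `≡ₑ`-class. -/
def edeg (A : Set ℕ) : Set (Set ℕ) := {B | EEquiv A B}

/-- `K_A = {⟨i,n⟩ : n ∈ Γ_i(A)}`. -/
def KSet (A : Set ℕ) : Set ℕ := {m | m.unpair.2 ∈ eOp m.unpair.1 A}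

/-- The skip `A^⋄ = ℕ \ K_A`. -/
def eSkip (A : Set ℕ) : Set ℕ := (KSet A)ᶜ

/-- `A ⊕ B = {2n : n ∈ A} ∪ {2n+1 : n ∈ B}`. -/
def eJoin (A B : Set ℕ) : Set ℕ :=
  {n | (∃ m ∈ A, n = 2 * m) ∨ (∃ m ∈ B, n = 2 * m + 1)}

/-- The enumeration jump `A' = K_A ⊕ (ℕ \ K_A)`. -/
def eJump (A : Set ℕ) : Set ℕ := eJoin (KSet A) (KSet A)ᶜ

/-- `u` is a uniformity function for `f` on the domain `D`. -/
def IsUniformityOn (D : Set (Set ℕ)) (f : Set ℕ → Set ℕ) (u : ℕ → ℕ) : Prop :=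
  ∀ A ∈ D, ∀ B ∈ D, ∀ i j : ℕ, EEquivVia A B i j →
    EEquivVia (f A) (f B) (u (Nat.pair i j)).unpair.1 (u (Nat.pair i j)).unpair.2

/-- `f` is uniformly e-invariant on the domain `D`. -/
def UniformlyEInvariantOn (D : Set (Set ℕ)) (f : Set ℕ → Set ℕ) : Prop :=
  ∃ u : ℕ → ℕ, IsUniformityOn D f u

/-- `f` is uniformly e-invariant. -/
def UniformlyEInvariant (f : Set ℕ → Set ℕ) : Prop :=
  UniformlyEInvariantOn Set.univ f

/-- `f` is e-invariant. -/
def EInvariant (f : Set ℕ → Set ℕ) : Prop :=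
  ∀ A B : Set ℕ, EEquiv A B → EEquiv (f A) (f B)

/-- `f ≤ₑ^▽ g`: `f` is e-below `g` on a cone. -/
def ConeLe (f g : Set ℕ → Set ℕ) : Prop :=
  ∃ D : Set ℕ, ∀ X : Set ℕ, ELe D X → ELe (f X) (g X)

/-- Borel functions on Cantor space `P(ℕ)`. -/
def BorelFun (F : Set ℕ → Set ℕ) : Prop := Measurable F

/-- `A` has cototal enumeration degree: `A ≡ₑ C` for some `C` with `C ≤ₑ Cᶜ`. -/
def HasCototalDeg (A : Set ℕ) : Prop := ∃ C : Set ℕ, EEquiv A C ∧ ELe C Cᶜ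

/-- `h(A) = A` if `A` has cototal degree, and `h(A) = A^⋄` otherwise. -/
noncomputable def patchFun (A : Set ℕ) : Set ℕ :=
  if HasCototalDeg A then A else eSkip A


/-! ### Computability preliminaries -/

/-- Step-bounded membership in the `e`-th c.e. set. -/
def ceStep (k e n : ℕ) : Prop :=
  (Nat.Partrec.Code.evaln k (Denumerable.ofNat Nat.Partrec.Code e) n).isSome = true

theorem mem_ceSet_iff (e n : ℕ) : n ∈ ceSet e ↔ ∃ k, ceStep k e n := by
  unfold ceSet ceStep
  rw [Set.mem_ofPred_eq, Part.dom_iff_mem]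
  constructor
  · rintro ⟨x, hx⟩
    obtain ⟨k, hk⟩ := Nat.Partrec.Code.evaln_complete.1 hx
    exact ⟨k, Option.isSome_iff_exists.2 ⟨x, hk⟩⟩
  · rintro ⟨k, hk⟩
    obtain ⟨x, hx⟩ := Option.isSome_iff_exists.1 hk
    exact ⟨x, Nat.Partrec.Code.evaln_complete.2 ⟨k, hx⟩⟩

theorem ceStep_mono {k l e n : ℕ} (hkl : k ≤ l) (h : ceStep k e n) : ceStep l e n := by
  obtain ⟨x, hx⟩ := Option.isSome_iff_exists.1 h
  exact Option.isSome_iff_exists.2 ⟨x, Nat.Partrec.Code.evaln_mono hkl hx⟩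

theorem ceStep_bound {k e n : ℕ} (h : ceStep k e n) : n < k := by
  obtain ⟨x, hx⟩ := Option.isSome_iff_exists.1 h
  exact Nat.Partrec.Code.evaln_bound hx

theorem ceStep_primrec {α : Type*} [Primcodable α] {f g h : α → ℕ} (hf : Primrec f)
    (hg : Primrec g) (hh : Primrec h) : PrimrecPred fun a => ceStep (f a) (g a) (h a) := by
  unfold ceStep
  have := Nat.Partrec.Code.primrec_evaln.comp
    ((hf.pair ((Primrec.ofNat Nat.Partrec.Code).comp hg)).pair hh)
  exact Primrec.eq.comp (Primrec.option_isSome.comp this) (Primrec.const true)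

theorem bforall_primrec {α : Type*} [Primcodable α] {f : α → ℕ} {R : ℕ → α → Prop}
    (hf : Primrec f) (hR : PrimrecPred fun p : ℕ × α => R p.1 p.2) :
    PrimrecPred fun a => ∀ x < f a, R x a := by
  have h : PrimrecRel R := hR
  exact (h.forall_mem_list.comp (Primrec.list_range.comp hf) Primrec.id).of_eq (by simp)

theorem bexists_primrec {α : Type*} [Primcodable α] {f : α → ℕ} {R : ℕ → α → Prop}
    (hf : Primrec f) (hR : PrimrecPred fun p : ℕ × α => R p.1 p.2) :
    PrimrecPred fun a => ∃ x < f a, R x a := by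
  have h : PrimrecRel R := hR
  exact (h.exists_mem_list.comp (Primrec.list_range.comp hf) Primrec.id).of_eq (by simp)

theorem imp_primrec {α : Type*} [Primcodable α] {p q : α → Prop}
    (hp : PrimrecPred p) (hq : PrimrecPred q) : PrimrecPred fun a => (p a → q a) :=
  (hp.not.or hq).of_eq fun a => by tauto

theorem twoPow_primrec : Primrec fun n : ℕ => 2 ^ n := by
  have : Primrec fun n : ℕ => (fun m : ℕ => 2 * m)^[n] 1 :=
    Primrec.nat_iterate Primrec.id (Primrec.const 1) (Primrec.nat_double.comp Primrec.snd).to₂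
  refine this.of_eq fun n => ?_
  induction n with
  | zero => simp
  | succ n ih => rw [Function.iterate_succ_apply', ih, pow_succ]; ring

theorem testBit_primrec {α : Type*} [Primcodable α] {f g : α → ℕ} (hf : Primrec f)
    (hg : Primrec g) : PrimrecPred fun a => (f a).testBit (g a) = true := by
  have h1 := Primrec.nat_div.comp hf (twoPow_primrec.comp hg)
  have h2 := Primrec.nat_mod.comp h1 (Primrec.const 2)
  exact (Primrec.eq.comp h2 (Primrec.const 1)).of_eq fun a => by
    rw [Nat.testBit_eq_decide_div_mod_eq]; simp

theorem testBit_lt {u m : ℕ} (h : u.testBit m = true) : m < u :=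
  lt_of_lt_of_le Nat.lt_two_pow_self (Nat.ge_two_pow_of_testBit h)

/-- Basic criterion for enumeration reducibility. -/
theorem ELe_of_primrec {A B : Set ℕ} (P : (ℕ × ℕ) × ℕ → Prop) (hP : PrimrecPred P)
    (h : ∀ n, n ∈ A ↔ ∃ u k, P ((n, u), k) ∧ finCode u ⊆ B) : ELe A B := by
  have h1 : Partrec fun p : ℕ => Nat.rfind fun k => (Part.some (decide (P (p.unpair, k))) : Part Bool) := by
    apply Partrec.rfind
    have h2 : Primrec fun a : ℕ × ℕ => decide (P (a.1.unpair, a.2)) :=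
      (hP.comp ((Primrec.unpair.comp Primrec.fst).pair Primrec.snd)).decide
    exact h2.to_comp.partrec
  obtain ⟨c, hc⟩ := Nat.Partrec.Code.exists_code.1 (Partrec.nat_iff.1 h1)
  refine ⟨Encodable.encode c, ?_⟩
  have key : ∀ n u, Nat.pair n u ∈ ceSet (Encodable.encode c) ↔ ∃ k, P ((n, u), k) := by
    intro n u
    unfold ceSet
    rw [Set.mem_ofPred_eq, Denumerable.ofNat_encode, hc]
    refine Nat.rfind_dom.trans ?_
    simp
  ext n
  rw [h n]
  simp only [eOp, Set.mem_ofPred_eq, key]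
  constructor
  · rintro ⟨u, k, h1, h2⟩; exact ⟨u, ⟨k, h1⟩, h2⟩
  · rintro ⟨u, ⟨k, h1⟩, h2⟩; exact ⟨u, k, h1, h2⟩

theorem finCode_twoPow (n : ℕ) (B : Set ℕ) : finCode (2 ^ n) ⊆ B ↔ n ∈ B := by
  have : finCode (2 ^ n) = {n} := by
    ext m; simp [finCode, Nat.testBit_two_pow, eq_comm]
  rw [this, Set.singleton_subset_iff]

/-- Many-one reducibility implies enumeration reducibility. -/
theorem ELe_of_map {A B : Set ℕ} {f : ℕ → ℕ} (hf : Primrec f) (h : ∀ n, n ∈ A ↔ f n ∈ B) :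
    ELe A B := by
  refine ELe_of_primrec (fun p => p.1.2 = 2 ^ (f p.1.1)) ?_ ?_
  · exact Primrec.eq.comp (Primrec.snd.comp Primrec.fst)
      (twoPow_primrec.comp (hf.comp (Primrec.fst.comp Primrec.fst)))
  · intro n
    rw [h n]
    constructor
    · intro hn; exact ⟨2 ^ f n, 0, rfl, (finCode_twoPow _ _).2 hn⟩
    · rintro ⟨u, k, hu, hs⟩
      have hu : u = 2 ^ f n := hu
      subst hu
      exact (finCode_twoPow _ _).1 hs

theorem ELe_refl (A : Set ℕ) : ELe A A := ELe_of_map Primrec.id fun _ => Iff.rfl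

theorem finCode_or (u v : ℕ) : finCode (u ||| v) = finCode u ∪ finCode v := by
  ext n; simp [finCode]

theorem collect (j u : ℕ) (C : Set ℕ) (N : ℕ)
    (h : ∀ m < N, u.testBit m = true → m ∈ eOp j C) :
    ∃ w k, finCode w ⊆ C ∧ ∀ m < N, u.testBit m = true →
      ∃ v, ceStep k j (Nat.pair m v) ∧ finCode v ⊆ finCode w := by
  induction N with
  | zero => exact ⟨0, 0, by intro x hx; simp [finCode] at hx, by simp⟩
  | succ N ih =>
    obtain ⟨w, k, hw, hk⟩ := ih fun m hm => h m (by omega)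
    by_cases hN : u.testBit N = true
    · obtain ⟨v, hv, hvC⟩ := h N (by omega) hN
      obtain ⟨l, hl⟩ := (mem_ceSet_iff _ _).1 hv
      refine ⟨w ||| v, max k l, ?_, ?_⟩
      · rw [finCode_or]; exact Set.union_subset hw hvC
      · intro m hm hb
        rw [finCode_or]
        rcases Nat.lt_succ_iff_lt_or_eq.1 hm with hm | rfl
        · obtain ⟨v', h1, h2⟩ := hk m hm hb
          exact ⟨v', ceStep_mono (le_max_left _ _) h1, h2.trans Set.subset_union_left⟩
        · exact ⟨v, ceStep_mono (le_max_right _ _) hl, Set.subset_union_right⟩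
    · refine ⟨w, k, hw, ?_⟩
      intro m hm hb
      rcases Nat.lt_succ_iff_lt_or_eq.1 hm with hm | rfl
      · exact hk m hm hb
      · exact absurd hb hN

theorem ELe_trans {A B C : Set ℕ} (h1 : ELe A B) (h2 : ELe B C) : ELe A C := by
  obtain ⟨i, hi⟩ := h1
  obtain ⟨j, hj⟩ := h2
  unfold ELeVia at hi hj
  refine ELe_of_primrec (fun p => ∃ u < p.2, ceStep p.2 i (Nat.pair p.1.1 u) ∧
    ∀ m < u, u.testBit m = true → ∃ v < p.2, ceStep p.2 j (Nat.pair m v) ∧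
      ∀ x < v, v.testBit x = true → p.1.2.testBit x = true) ?_ ?_
  · refine bexists_primrec (f := fun p : (ℕ × ℕ) × ℕ => p.2) Primrec.snd ?_
    refine PrimrecPred.and (ceStep_primrec (Primrec.snd.comp Primrec.snd) (Primrec.const i)
      (Primrec₂.natPair.comp (Primrec.fst.comp (Primrec.fst.comp Primrec.snd)) Primrec.fst)) ?_
    refine bforall_primrec (f := fun p : ℕ × ((ℕ × ℕ) × ℕ) => p.1) Primrec.fst ?_
    refine imp_primrec (testBit_primrec (Primrec.fst.comp Primrec.snd) Primrec.fst) ?_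
    refine bexists_primrec (f := fun p : ℕ × (ℕ × ((ℕ × ℕ) × ℕ)) => p.2.2.2)
      (Primrec.snd.comp (Primrec.snd.comp Primrec.snd)) ?_
    refine PrimrecPred.and (ceStep_primrec
      (Primrec.snd.comp (Primrec.snd.comp (Primrec.snd.comp Primrec.snd))) (Primrec.const j)
      (Primrec₂.natPair.comp (Primrec.fst.comp Primrec.snd) Primrec.fst)) ?_
    refine bforall_primrec (f := fun p : ℕ × (ℕ × (ℕ × ((ℕ × ℕ) × ℕ))) => p.1) Primrec.fst ?_
    refine imp_primrec (testBit_primrec (Primrec.fst.comp Primrec.snd) Primrec.fst) ?_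
    exact testBit_primrec (Primrec.snd.comp (Primrec.fst.comp (Primrec.snd.comp
      (Primrec.snd.comp (Primrec.snd.comp Primrec.snd))))) Primrec.fst
  · intro n
    constructor
    · intro hn
      rw [hi] at hn
      obtain ⟨u, hu, huB⟩ := hn
      rw [hj] at huB
      obtain ⟨k, hk⟩ := (mem_ceSet_iff _ _).1 hu
      obtain ⟨w, l, hw, hl⟩ := collect j u C u fun m _ hm => huB hm
      refine ⟨w, max k l, ?_, hw⟩
      have hk' := ceStep_mono (le_max_left k l) hk
      refine ⟨u, lt_of_le_of_lt (Nat.right_le_pair _ _) (ceStep_bound hk'), hk', ?_⟩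
      intro m hm hb
      obtain ⟨v, h1, h2⟩ := hl m hm hb
      have h1' := ceStep_mono (le_max_right k l) h1
      exact ⟨v, lt_of_le_of_lt (Nat.right_le_pair _ _) (ceStep_bound h1'), h1',
        fun x _ hx => h2 hx⟩
    · rintro ⟨w, k, ⟨u, _, hu, hall⟩, hw⟩
      rw [hi]
      refine ⟨u, (mem_ceSet_iff _ _).2 ⟨k, hu⟩, ?_⟩
      intro m hm
      rw [hj]
      obtain ⟨v, _, hv, hvw⟩ := hall m (testBit_lt hm) hm
      exact ⟨v, (mem_ceSet_iff _ _).2 ⟨k, hv⟩, fun x hx => hw (hvw x (testBit_lt hx) hx)⟩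

/-! ### The operators `K` and skip -/

theorem KSet_le (A : Set ℕ) : ELe (KSet A) A := by
  refine ELe_of_primrec
    (fun p => ceStep p.2 p.1.1.unpair.1 (Nat.pair p.1.1.unpair.2 p.1.2)) ?_ ?_
  · have h := Primrec.unpair.comp
      (Primrec.fst.comp (Primrec.fst : Primrec (Prod.fst : (ℕ × ℕ) × ℕ → ℕ × ℕ)))
    exact ceStep_primrec Primrec.snd (Primrec.fst.comp h)
      (Primrec₂.natPair.comp (Primrec.snd.comp h) (Primrec.snd.comp Primrec.fst))
  · intro n
    simp only [KSet, eOp, Set.mem_ofPred_eq, mem_ceSet_iff]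
    constructor
    · rintro ⟨u, ⟨k, h1⟩, h2⟩; exact ⟨u, k, h1, h2⟩
    · rintro ⟨u, k, h1, h2⟩; exact ⟨u, ⟨k, h1⟩, h2⟩

theorem pairConst_primrec (j : ℕ) : Primrec fun n : ℕ => Nat.pair j n :=
  Primrec₂.natPair.comp (Primrec.const j) Primrec.id

theorem mem_iff_KSet {A B : Set ℕ} {j : ℕ} (h : A = eOp j B) (n : ℕ) :
    n ∈ A ↔ Nat.pair j n ∈ KSet B := by
  rw [h]; simp [KSet]

theorem le_KSet (A : Set ℕ) : ELe A (KSet A) := by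
  obtain ⟨j, hj⟩ := ELe_refl A
  exact ELe_of_map (pairConst_primrec j) (mem_iff_KSet hj)

theorem compl_le_eSkip {A B : Set ℕ} (h : ELe A B) : ELe Aᶜ (eSkip B) := by
  obtain ⟨j, hj⟩ := h
  exact ELe_of_map (pairConst_primrec j) fun n => not_congr (mem_iff_KSet hj n)

theorem eSkip_mono {A B : Set ℕ} (h : ELe A B) : ELe (eSkip A) (eSkip B) :=
  compl_le_eSkip (ELe_trans (KSet_le A) h)

theorem eSkip_not_le (A : Set ℕ) : ¬ ELe (eSkip A) A := by
  intro h
  have hd : ELe {n | Nat.pair n n ∈ eSkip A} (eSkip A) :=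
    ELe_of_map (f := fun n => Nat.pair n n) (Primrec₂.natPair.comp Primrec.id Primrec.id)
      fun _ => Iff.rfl
  obtain ⟨i, hi⟩ := ELe_trans hd h
  have h1 := mem_iff_KSet hi i
  have h2 : i ∈ {n | Nat.pair n n ∈ eSkip A} ↔ ¬ Nat.pair i i ∈ KSet A := Iff.rfl
  tauto

theorem cototal_iff (A : Set ℕ) : HasCototalDeg A ↔ ELe A (eSkip A) := by
  constructor
  · rintro ⟨C, ⟨h1, h2⟩, h3⟩
    exact ELe_trans h1 (ELe_trans h3 (compl_le_eSkip h2))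
  · intro h
    exact ⟨KSet A, ⟨le_KSet A, KSet_le A⟩, ELe_trans (KSet_le A) h⟩

theorem eOp_mono (i : ℕ) {A B : Set ℕ} (h : A ⊆ B) : eOp i A ⊆ eOp i B := by
  rintro n ⟨u, h1, h2⟩
  exact ⟨u, h1, h2.trans h⟩

theorem eSkip_anti {A B : Set ℕ} (h : A ⊆ B) : eSkip B ⊆ eSkip A :=
  Set.compl_subset_compl.2 fun _ hm => eOp_mono _ h hm

/-! ### Joins -/

theorem even_mem_eJoin (A B : Set ℕ) (n : ℕ) : 2 * n ∈ eJoin A B ↔ n ∈ A := by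
  constructor
  · rintro (⟨m, hm, h⟩ | ⟨m, hm, h⟩)
    · obtain rfl : n = m := by omega
      exact hm
    · omega
  · intro h; exact Or.inl ⟨n, h, rfl⟩

theorem odd_mem_eJoin (A B : Set ℕ) (n : ℕ) : 2 * n + 1 ∈ eJoin A B ↔ n ∈ B := by
  constructor
  · rintro (⟨m, hm, h⟩ | ⟨m, hm, h⟩)
    · omega
    · obtain rfl : n = m := by omega
      exact hm
  · intro h; exact Or.inr ⟨n, h, rfl⟩

theorem left_le_eJoin (A B : Set ℕ) : ELe A (eJoin A B) :=
  ELe_of_map Primrec.nat_double fun n => (even_mem_eJoin A B n).symm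

theorem right_le_eJoin (A B : Set ℕ) : ELe B (eJoin A B) :=
  ELe_of_map Primrec.nat_double_succ fun n => (odd_mem_eJoin A B n).symm

/-- The total set `X ⊕ Xᶜ`. -/
def tot (X : Set ℕ) : Set ℕ := eJoin X Xᶜ

theorem tot_le_compl (X : Set ℕ) : ELe (tot X) (tot X)ᶜ := by
  have hf : Primrec fun n : ℕ => if n % 2 = 0 then n + 1 else n - 1 :=
    Primrec.ite (Primrec.eq.comp (Primrec.nat_mod.comp Primrec.id (Primrec.const 2))
      (Primrec.const 0)) Primrec.succ Primrec.pred
  refine ELe_of_map hf fun n => ?_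
  unfold tot
  rw [Set.mem_compl_iff]
  rcases Nat.even_or_odd' n with ⟨m, rfl | rfl⟩
  · rw [if_pos (by omega), even_mem_eJoin, odd_mem_eJoin]; simp
  · rw [if_neg (by omega), Nat.add_sub_cancel, even_mem_eJoin, odd_mem_eJoin]; simp

theorem tot_cototal (X : Set ℕ) : HasCototalDeg (tot X) :=
  ⟨tot X, ⟨ELe_refl _, ELe_refl _⟩, tot_le_compl X⟩

theorem patchFun_tot (X : Set ℕ) : patchFun (tot X) = tot X := if_pos (tot_cototal X)

theorem le_tot (X : Set ℕ) : ELe X (tot X) := left_le_eJoin _ _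

/-! ### A non-cototal degree above any given one: an uncountable chain meets
each antichain `{B : B = Γ_e (B^⋄)}` at most once. -/

/-- A chain of sets above `X`, indexed by the reals. -/
def chainSet (X : Set ℕ) (r : ℝ) : Set ℕ :=
  eJoin X {n | ∃ q : ℚ, Encodable.decode n = some q ∧ (q : ℝ) < r}

theorem exists_not_cototal (X : Set ℕ) : ∃ B, ELe X B ∧ ¬ ELe B (eSkip B) := by
  by_contra hcon
  push Not at hcon
  have hall : ∀ r : ℝ, ∃ i, chainSet X r = eOp i (eSkip (chainSet X r)) := fun r =>
    hcon (chainSet X r) (left_le_eJoin _ _)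
  choose e he using hall
  have hmono : ∀ r s : ℝ, r ≤ s → chainSet X r ⊆ chainSet X s := by
    rintro r s hrs n (⟨m, hm, h⟩ | ⟨m, hm, h⟩)
    · exact Or.inl ⟨m, hm, h⟩
    · obtain ⟨q, hq, hqr⟩ := hm
      exact Or.inr ⟨m, ⟨q, hq, lt_of_lt_of_le hqr hrs⟩, h⟩
  have hlt : ∀ r s : ℝ, r < s → e r ≠ e s := by
    intro r s hrs hes
    have hsub : chainSet X s ⊆ chainSet X r := by
      rw [he s, he r, hes]
      exact eOp_mono _ (eSkip_anti (hmono r s hrs.le))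
    obtain ⟨q, hq1, hq2⟩ := exists_rat_btwn hrs
    have h1 : 2 * Encodable.encode q + 1 ∈ chainSet X s := by
      exact (odd_mem_eJoin _ _ _).2 ⟨q, Encodable.encodek q, hq2⟩
    obtain ⟨q', hq', hlt'⟩ := (odd_mem_eJoin _ _ _).1 (hsub h1)
    rw [Encodable.encodek] at hq'
    obtain rfl : q = q' := Option.some.inj hq'
    linarith
  have hinj : Function.Injective e := by
    intro r s h
    rcases lt_trichotomy r s with h' | h' | h'
    · exact absurd h (hlt r s h')
    · exact h'
    · exact absurd h.symm (hlt s r h')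
  exact not_countable (α := ℝ) hinj.countable

/-! ### Borel measurability -/

theorem measurable_eOp (i : ℕ) : Measurable (eOp i) := by
  rw [measurable_set_iff]
  intro n
  have : ∀ u : ℕ, Measurable fun B : Set ℕ => Nat.pair n u ∈ ceSet i ∧ finCode u ⊆ B := by
    intro u
    refine Measurable.and measurable_const ?_
    change Measurable fun B : Set ℕ => ∀ x, x ∈ finCode u → x ∈ B
    exact Measurable.forall fun x => Measurable.imp measurable_const (measurable_set_mem x)
  exact Measurable.exists this

theorem measurable_KSet : Measurable KSet := by
  rw [measurable_set_iff]
  intro m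
  exact measurable_set_iff.1 (measurable_eOp m.unpair.1) m.unpair.2

theorem measurable_eSkip : Measurable eSkip := measurable_compl.comp measurable_KSet

theorem measurable_patchFun : Measurable patchFun := by
  have hset : MeasurableSet {A : Set ℕ | HasCototalDeg A} := by
    have : {A : Set ℕ | HasCototalDeg A} = ⋃ i, {A | A = eOp i (eSkip A)} := by
      ext A
      simp only [Set.mem_ofPred_eq, Set.mem_iUnion, cototal_iff]
      rfl
    rw [this]
    refine MeasurableSet.iUnion fun i => ?_
    have hg : Measurable fun A => eOp i (eSkip A) := (measurable_eOp i).comp measurable_eSkip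
    have : {A : Set ℕ | A = eOp i (eSkip A)} = ⋂ n, {A | n ∈ A ↔ n ∈ eOp i (eSkip A)} := by
      ext A
      simp only [Set.mem_ofPred_eq, Set.mem_iInter]
      exact Set.ext_iff
    rw [this]
    refine MeasurableSet.iInter fun n => ?_
    exact measurableSet_setOfPred.2
      (Measurable.iff (measurable_set_mem n) (measurable_set_iff.1 hg n))
  exact Measurable.ite hset measurable_id measurable_eSkip

theorem patchFun_invariant : EInvariant patchFun := by
  rintro A B ⟨h1, h2⟩
  have hiff : HasCototalDeg A ↔ HasCototalDeg B := by
    rw [cototal_iff, cototal_iff]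
    exact ⟨fun h => ELe_trans h2 (ELe_trans h (eSkip_mono h1)),
      fun h => ELe_trans h1 (ELe_trans h (eSkip_mono h2))⟩
  unfold patchFun
  by_cases h : HasCototalDeg A
  · rw [if_pos h, if_pos (hiff.1 h)]; exact ⟨h1, h2⟩
  · rw [if_neg h, if_neg (fun hB => h (hiff.2 hB))]; exact ⟨eSkip_mono h1, eSkip_mono h2⟩

/-- The patch function `h` is a Borel e-invariant function; for every `X` there
are `A, B ≥ₑ X` with `A ≤ₑ h(A)`, `B ≰ₑ h(B)`, `h(A) <ₑ A^⋄` and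
`B^⋄ ≤ₑ h(B)`.  Consequently `h` is not constant and not increasing on any
upper cone of enumeration degrees. -/
theorem patchFun_wild :
    BorelFun patchFun ∧ EInvariant patchFun ∧
    (∀ X : Set ℕ, ∃ A B : Set ℕ, ELe X A ∧ ELe X B ∧
      ELe A (patchFun A) ∧ ¬ ELe B (patchFun B) ∧
      ELt (patchFun A) (eSkip A) ∧ ELe (eSkip B) (patchFun B)) ∧
    (∀ D : Set ℕ, ¬ ∀ X : Set ℕ, ELe D X → ∀ Y : Set ℕ, ELe D Y →
      EEquiv (patchFun X) (patchFun Y)) ∧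
    (∀ D : Set ℕ, ¬ ∀ X : Set ℕ, ELe D X → ELe X (patchFun X)) ∧
    (∀ D : Set ℕ, ¬ ∀ X : Set ℕ, ELe D X → ELe (eJump X) (patchFun X)) ∧
    (∀ D : Set ℕ, ¬ ∀ X : Set ℕ, ELe D X → ELe (eSkip X) (patchFun X)) := by
  have hB : ∀ X : Set ℕ, ∃ B, ELe X B ∧ ¬ ELe B (patchFun B) ∧ ELe (eSkip B) (patchFun B) := by
    intro X
    obtain ⟨B, h1, h2⟩ := exists_not_cototal X
    have hp : patchFun B = eSkip B := if_neg (fun h => h2 ((cototal_iff B).1 h))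
    exact ⟨B, h1, by rwa [hp], by rw [hp]; exact ELe_refl _⟩
  refine ⟨measurable_patchFun, patchFun_invariant, ?_, ?_, ?_, ?_, ?_⟩
  · intro X
    obtain ⟨B, h1, h2, h3⟩ := hB X
    refine ⟨tot X, B, le_tot X, h1, ?_, h2, ?_, h3⟩
    · rw [patchFun_tot]; exact ELe_refl _
    · rw [patchFun_tot]
      exact ⟨(cototal_iff _).1 (tot_cototal X), eSkip_not_le _⟩
  · intro D h
    have hD : ELe D (tot (eSkip (tot D))) :=
      ELe_trans (le_tot D) (ELe_trans ((cototal_iff _).1 (tot_cototal D)) (le_tot _))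
    have := (h _ (le_tot D) _ hD).2
    rw [patchFun_tot, patchFun_tot] at this
    exact eSkip_not_le _ (ELe_trans (le_tot _) this)
  · intro D h
    obtain ⟨B, h1, h2, _⟩ := hB D
    exact h2 (h B h1)
  · intro D h
    have := h _ (le_tot D)
    rw [patchFun_tot] at this
    exact eSkip_not_le _ (ELe_trans (right_le_eJoin _ _) this)
  · intro D h
    have := h _ (le_tot D)
    rw [patchFun_tot] at this
    exact eSkip_not_le _ this
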